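/- Let c : Δ → ℝ^{d×d} be a measurable field of symmetric positive semidefinite matrices and p : Δ → (0,∞) measurable with ∫_Δ |c_{ij}(x)| / (x^i x^j) · p(x) dx < ∞ for all i, j ∈ {1,…,d}. Then there exists a sequence of functions η_m : Δ → ℝ, each the restriction to Δ of a C^∞ function on ℝ^d, such that: (i) 0 ≤ η_m ≤ 1 on Δ for every m; (ii) the closure in Δ of {x ∈ Δ : η_m(x) ≠ 0} is compact for every m; (iii) η_m(x) → 1 as m → ∞ for every x ∈ Δ; and (iv) ∫_Δ ∇η_m(x)ᵀ c(x) ∇η_m(x) p(x) dx → 0 as m → ∞. -/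

import Mathlib

open scoped BigOperators
open MeasureTheory Filter

/-- The open unit simplex in `ℝ^d`. -/
def openSimplex (d : ℕ) : Set (Fin d → ℝ) :=
  {x | (∀ i, 0 < x i) ∧ ∑ i, x i = 1}

/-- The partial derivative `∂_i f (x)`. -/
noncomputable def pd {d : ℕ} (f : (Fin d → ℝ) → ℝ) (i : Fin d) (x : Fin d → ℝ) : ℝ :=
  fderiv ℝ f x (Pi.single i 1)

/-- The `(d-1)`-dimensional Lebesgue measure on the hyperplane `{∑ xᶦ = 1}`. -/
noncomputable def simplexMeasure (d : ℕ) : Measure (Fin d → ℝ) :=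
  Measure.map
    (fun y : Fin (d - 1) → ℝ => fun i : Fin d =>
      if h : (i : ℕ) < d - 1 then y ⟨(i : ℕ), h⟩ else 1 - ∑ j, y j)
    volume

/-- A smooth step function on `ℝ`, vanishing on `(-∞, 1]` and equal to `1` on `[2, ∞)`. -/
noncomputable def smoothStep (t : ℝ) : ℝ := Real.smoothTransition (t - 1)

lemma contDiff_smoothStep : ContDiff ℝ (⊤ : ℕ∞) smoothStep :=
  Real.smoothTransition.contDiff.comp (contDiff_id.sub contDiff_const)

lemma smoothStep_nonneg (t : ℝ) : 0 ≤ smoothStep t := Real.smoothTransition.nonneg _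

lemma smoothStep_le_one (t : ℝ) : smoothStep t ≤ 1 := Real.smoothTransition.le_one _

lemma smoothStep_of_le_one {t : ℝ} (h : t ≤ 1) : smoothStep t = 0 :=
  Real.smoothTransition.zero_of_nonpos (by linarith)

lemma smoothStep_of_two_le {t : ℝ} (h : 2 ≤ t) : smoothStep t = 1 :=
  Real.smoothTransition.one_of_one_le (by linarith)

lemma deriv_smoothStep_of_lt_one {t : ℝ} (h : t < 1) : deriv smoothStep t = 0 := by
  have : smoothStep =ᶠ[nhds t] fun _ => 0 := by
    filter_upwards [Iio_mem_nhds h] with s hs using smoothStep_of_le_one (le_of_lt hs)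
  rw [this.deriv_eq, deriv_const]

lemma deriv_smoothStep_of_two_lt {t : ℝ} (h : 2 < t) : deriv smoothStep t = 0 := by
  have : smoothStep =ᶠ[nhds t] fun _ => 1 := by
    filter_upwards [Ioi_mem_nhds h] with s hs using smoothStep_of_two_le (le_of_lt hs)
  rw [this.deriv_eq, deriv_const]

lemma exists_abs_mul_deriv_smoothStep_le :
    ∃ C : ℝ, 0 ≤ C ∧ ∀ t : ℝ, |t * deriv smoothStep t| ≤ C := by
  have hcont : Continuous fun t : ℝ => t * deriv smoothStep t :=
    continuous_id.mul (contDiff_smoothStep.continuous_deriv (by simp))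
  obtain ⟨C, hC⟩ := (isCompact_Icc (a := (1 : ℝ)) (b := 2)).exists_bound_of_continuousOn
    hcont.continuousOn
  have hC0 : 0 ≤ C := (norm_nonneg _).trans (hC 1 (by norm_num))
  refine ⟨C, hC0, fun t => ?_⟩
  rcases lt_or_ge t 1 with h1 | h1
  · simpa [deriv_smoothStep_of_lt_one h1] using hC0
  rcases lt_or_ge 2 t with h2 | h2
  · simpa [deriv_smoothStep_of_two_lt h2] using hC0
  exact hC t ⟨h1, h2⟩

/-- The product cutoff `x ↦ ∏ i, smoothStep (r * x i)`. -/
noncomputable def prodCutoff (d : ℕ) (r : ℝ) (x : Fin d → ℝ) : ℝ :=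
  ∏ i, smoothStep (r * x i)

section prodCutoff

variable {d : ℕ} {r : ℝ} {x : Fin d → ℝ}

lemma contDiff_prodCutoff (d : ℕ) (r : ℝ) : ContDiff ℝ (⊤ : ℕ∞) (prodCutoff d r) :=
  contDiff_prod fun i _ =>
    contDiff_smoothStep.comp (contDiff_const.mul (contDiff_apply ℝ ℝ i))

lemma prodCutoff_nonneg : 0 ≤ prodCutoff d r x :=
  Finset.prod_nonneg fun _ _ => smoothStep_nonneg _

lemma prodCutoff_le_one : prodCutoff d r x ≤ 1 :=
  Finset.prod_le_one (fun _ _ => smoothStep_nonneg _) fun _ _ => smoothStep_le_one _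

lemma one_lt_mul_of_prodCutoff_ne_zero (h : prodCutoff d r x ≠ 0) (i : Fin d) :
    1 < r * x i := by
  by_contra! hi
  exact h (Finset.prod_eq_zero (Finset.mem_univ i) (smoothStep_of_le_one hi))

lemma prodCutoff_eq_one (h : ∀ i, 2 ≤ r * x i) : prodCutoff d r x = 1 :=
  Finset.prod_eq_one fun i _ => smoothStep_of_two_le (h i)

lemma pd_prodCutoff (i : Fin d) :
    pd (prodCutoff d r) i x =
      (∏ j ∈ Finset.univ.erase i, smoothStep (r * x j)) * (deriv smoothStep (r * x i) * r) := by
  have hg : ∀ j ∈ (Finset.univ : Finset (Fin d)),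
      HasFDerivAt (fun y : Fin d → ℝ => smoothStep (r * y j))
        (deriv smoothStep (r * x j) •
          (r • ContinuousLinearMap.proj (R := ℝ) (φ := fun _ : Fin d => ℝ) j)) x := by
    intro j _
    have h1 : HasDerivAt smoothStep (deriv smoothStep (r * x j)) (r * x j) :=
      (contDiff_smoothStep.differentiable (by simp) _).hasDerivAt
    have h2 : HasFDerivAt (fun y : Fin d → ℝ => r * y j)
        (r • ContinuousLinearMap.proj (R := ℝ) (φ := fun _ : Fin d => ℝ) j) x :=
      (hasFDerivAt_apply j x).const_mul r
    exact HasDerivAt.comp_hasFDerivAt (h₂ := smoothStep) x h1 h2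
  have h : HasFDerivAt (prodCutoff d r) _ x := HasFDerivAt.finsetProd hg
  rw [pd, h.fderiv, _root_.sum_apply, Finset.sum_eq_single i]
  · simp
  · intro j _ hj
    simp [hj]
  · simp

lemma abs_pd_prodCutoff_le {C : ℝ} (hC : ∀ t : ℝ, |t * deriv smoothStep t| ≤ C)
    {i : Fin d} (hi : 0 < x i) : |pd (prodCutoff d r) i x| ≤ C / x i := by
  have hprod : |∏ j ∈ Finset.univ.erase i, smoothStep (r * x j)| ≤ 1 := by
    rw [abs_of_nonneg (Finset.prod_nonneg fun _ _ => smoothStep_nonneg _)]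
    exact Finset.prod_le_one (fun _ _ => smoothStep_nonneg _) fun _ _ => smoothStep_le_one _
  have hderiv : |deriv smoothStep (r * x i) * r| ≤ C / x i := by
    rw [le_div_iff₀ hi]
    calc _ = |r * x i * deriv smoothStep (r * x i)| := by
          simp only [abs_mul, abs_of_pos hi]
          ring
      _ ≤ C := hC _
  rw [pd_prodCutoff, abs_mul]
  calc _ ≤ 1 * |deriv smoothStep (r * x i) * r| := by gcongr
    _ ≤ C / x i := by rwa [one_mul]

lemma pd_prodCutoff_eq_zero {i : Fin d} (h : 2 < r * x i) : pd (prodCutoff d r) i x = 0 := by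
  rw [pd_prodCutoff, deriv_smoothStep_of_two_lt h, zero_mul, mul_zero]

lemma measurable_pd_prodCutoff (r : ℝ) (i : Fin d) : Measurable (pd (prodCutoff d r) i) :=
  (((contDiff_prodCutoff d r).continuous_fderiv (by simp)).clm_apply continuous_const).measurable

end prodCutoff

lemma measurableSet_openSimplex (d : ℕ) : MeasurableSet (openSimplex d) := by
  have : openSimplex d =
      (⋂ i, {x : Fin d → ℝ | 0 < x i}) ∩ {x : Fin d → ℝ | ∑ i, x i = 1} := by
    ext x
    simp [openSimplex]
  rw [this]
  refine (MeasurableSet.iInter fun i => ?_).inter ?_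
  · exact measurableSet_lt measurable_const (measurable_pi_apply i)
  · exact measurableSet_eq_fun (by fun_prop) measurable_const

lemma isCompact_support_prodCutoff (d : ℕ) {r : ℝ} (hr : 0 < r) :
    IsCompact (closure {x | x ∈ openSimplex d ∧ prodCutoff d r x ≠ 0} ∩ openSimplex d) := by
  set K : Set (Fin d → ℝ) := {x | (∀ i, r⁻¹ ≤ x i) ∧ ∑ i, x i = 1}
  have hKsub : K ⊆ openSimplex d := fun x hx =>
    ⟨fun i => (inv_pos.2 hr).trans_le (hx.1 i), hx.2⟩
  have hKclosed : IsClosed K := by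
    have : K = (⋂ i, {x : Fin d → ℝ | r⁻¹ ≤ x i}) ∩ {x : Fin d → ℝ | ∑ i, x i = 1} := by
      ext x
      simp [K]
    rw [this]
    refine (isClosed_iInter fun i => ?_).inter ?_
    · exact isClosed_le continuous_const (continuous_apply i)
    · exact isClosed_eq (by fun_prop) continuous_const
  have hKcompact : IsCompact K := by
    refine (isCompact_univ_pi fun _ : Fin d => isCompact_Icc (a := (0 : ℝ)) (b := 1)).of_isClosed_subset
      hKclosed fun x hx i _ => ⟨((hKsub hx).1 i).le, ?_⟩
    rw [← hx.2]
    exact Finset.single_le_sum (fun j _ => ((hKsub hx).1 j).le) (Finset.mem_univ i)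
  have hsupp : closure {x | x ∈ openSimplex d ∧ prodCutoff d r x ≠ 0} ⊆ K := by
    refine closure_minimal (fun x hx => ⟨fun i => ?_, hx.1.2⟩) hKclosed
    rw [inv_le_iff_one_le_mul₀' hr]
    exact (one_lt_mul_of_prodCutoff_ne_zero hx.2 i).le
  rw [Set.inter_eq_left.2 (hsupp.trans hKsub)]
  exact hKcompact.of_isClosed_subset isClosed_closure hsupp

/-- existence of smooth `[0,1]`-valued cutoff functions `η_m` on the simplex
with compactly contained support, `η_m → 1` pointwise, and vanishing `H^{c,p}`-energy
`∫ ∇η_mᵀ c ∇η_m p → 0`. -/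
theorem statement12 {d : ℕ} (hd : 2 ≤ d)
    (c : Fin d → Fin d → (Fin d → ℝ) → ℝ)
    (hcmeas : ∀ i j, Measurable (c i j))
    (hcsymm : ∀ x ∈ openSimplex d, ∀ i j, c i j x = c j i x)
    (hcpsd : ∀ x ∈ openSimplex d, ∀ v : Fin d → ℝ,
      0 ≤ ∑ i, ∑ j, v i * c i j x * v j)
    (p : (Fin d → ℝ) → ℝ) (hpmeas : Measurable p)
    (hppos : ∀ x ∈ openSimplex d, 0 < p x)
    (hint : ∀ i j, IntegrableOn
      (fun x => |c i j x| / (x i * x j) * p x) (openSimplex d) (simplexMeasure d)) :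
    ∃ η : ℕ → (Fin d → ℝ) → ℝ,
      (∀ m, ContDiff ℝ (⊤ : ℕ∞) (η m)) ∧
      (∀ m, ∀ x ∈ openSimplex d, 0 ≤ η m x ∧ η m x ≤ 1) ∧
      (∀ m, IsCompact
        (closure {x | x ∈ openSimplex d ∧ η m x ≠ 0} ∩ openSimplex d)) ∧
      (∀ x ∈ openSimplex d, Tendsto (fun m => η m x) atTop (nhds 1)) ∧
      Tendsto
        (fun m => ∫ x in openSimplex d,
          (∑ i, ∑ j, pd (η m) i x * c i j x * pd (η m) j x) * p x ∂(simplexMeasure d))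
        atTop (nhds 0) := by
  obtain ⟨C, hC0, hC⟩ := exists_abs_mul_deriv_smoothStep_le
  have hlarge : ∀ x ∈ openSimplex d, ∀ᶠ m : ℕ in atTop, ∀ i, 2 < ((m : ℝ) + 1) * x i := by
    intro x hx
    refine eventually_all.2 fun i => ?_
    exact ((tendsto_natCast_atTop_atTop.atTop_add tendsto_const_nhds).atTop_mul_const
      (hx.1 i)).eventually_gt_atTop 2
  refine ⟨fun m => prodCutoff d ((m : ℝ) + 1), fun m => contDiff_prodCutoff d _,
    fun m x _ => ⟨prodCutoff_nonneg, prodCutoff_le_one⟩,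
    fun m => isCompact_support_prodCutoff d (by positivity), fun x hx => ?_, ?_⟩
  · refine tendsto_const_nhds.congr' ?_
    filter_upwards [hlarge x hx] with m hm
    exact (prodCutoff_eq_one fun i => (hm i).le).symm
  rw [← integral_zero (Fin d → ℝ) ℝ (μ := (simplexMeasure d).restrict (openSimplex d))]
  refine tendsto_integral_of_dominated_convergence
    (fun x => ∑ i, ∑ j, C ^ 2 * (|c i j x| / (x i * x j) * p x)) (fun m => ?_) ?_
    (fun m => ?_) ?_
  · have hpd := fun i : Fin d => measurable_pd_prodCutoff ((m : ℝ) + 1) i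
    refine Measurable.aestronglyMeasurable (Measurable.mul ?_ hpmeas)
    exact Finset.measurable_fun_sum _ fun i _ => Finset.measurable_fun_sum _ fun j _ =>
      ((hpd i).mul (hcmeas i j)).mul (hpd j)
  · exact integrable_finsetSum _ fun i _ => integrable_finsetSum _ fun j _ =>
      (hint i j).const_mul _
  · refine ae_restrict_of_forall_mem (measurableSet_openSimplex d) fun x hx => ?_
    have hp := hppos x hx
    rw [Finset.sum_mul]
    refine (norm_sum_le _ _).trans (Finset.sum_le_sum fun i _ => ?_)
    rw [Finset.sum_mul]
    refine (norm_sum_le _ _).trans (Finset.sum_le_sum fun j _ => ?_)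
    have hi := hx.1 i
    have hj := hx.1 j
    rw [Real.norm_eq_abs, abs_mul, abs_mul, abs_mul, abs_of_pos hp]
    calc _ ≤ C / x i * |c i j x| * (C / x j) * p x := by
          gcongr
          · exact abs_pd_prodCutoff_le hC hi
          · exact abs_pd_prodCutoff_le hC hj
      _ = C ^ 2 * (|c i j x| / (x i * x j) * p x) := by
          field_simp
  · refine ae_restrict_of_forall_mem (measurableSet_openSimplex d) fun x hx => ?_
    refine tendsto_const_nhds.congr' ?_
    filter_upwards [hlarge x hx] with m hm
    simp [pd_prodCutoff_eq_zero (hm _)]
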